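/- Let H : ℝⁿ × ℝⁿ → ℝ be continuous, satisfy (H1), (H2) and (H3c), be convex in p for each x (H5), and be uniformly superlinear in p: inf_x H(x,p)/|p| → +∞ as |p| → ∞ (H6). Let L(x,v) = sup_{p ∈ ℝⁿ} (p·v − H(x,p)) be the Legendre transform, and for each x ∈ ℝⁿ define u(x) = inf_{η ∈ A_x} ∫₀^∞ e^{−s} L(η(s), −η̇(s)) ds, where A_x is the set of absolutely continuous curves η : [0,∞) → ℝⁿ with η(0) = x. Then u is bounded and uniformly continuous on ℝⁿ, u is a viscosity solution of u(x) + H(x, Du(x)) = 0 in ℝⁿ, and there is a constant C_H depending only on H such that ‖u‖_{L^∞(ℝⁿ)} ≤ C_H and u is Lipschitz with constant C_H. -/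

import Mathlib

open Metric Set MeasureTheory Filter
open scoped Topology NNReal RealInnerProductSpace

noncomputable section

abbrev Euc (n : ℕ) := EuclideanSpace ℝ (Fin n)

/-- `v` is a viscosity subsolution of `v + H(x, Dv) = 0` in the open set `Ω`. -/
def IsViscositySubsolutionIn {n : ℕ} (Ω : Set (Euc n)) (H : Euc n → Euc n → ℝ)
    (v : Euc n → ℝ) : Prop :=
  ∀ x ∈ Ω, ∀ φ : Euc n → ℝ, ContDiff ℝ 1 φ →
    IsLocalMaxOn (fun y => v y - φ y) Ω x → v x + H x (gradient φ x) ≤ 0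

/-- `v` is a viscosity supersolution of `v + H(x, Dv) = 0` on the closure of `Ω`. -/
def IsViscositySupersolutionOn {n : ℕ} (Ω : Set (Euc n)) (H : Euc n → Euc n → ℝ)
    (v : Euc n → ℝ) : Prop :=
  ∀ x ∈ closure Ω, ∀ φ : Euc n → ℝ, ContDiff ℝ 1 φ →
    IsLocalMinOn (fun y => v y - φ y) (closure Ω) x → 0 ≤ v x + H x (gradient φ x)

/-- `v` is a state-constraint viscosity solution on `Ω`. -/
def IsStateConstraintSolution {n : ℕ} (Ω : Set (Euc n)) (H : Euc n → Euc n → ℝ)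
    (v : Euc n → ℝ) : Prop :=
  ContinuousOn v (closure Ω) ∧ IsViscositySubsolutionIn Ω H v ∧
    IsViscositySupersolutionOn Ω H v

/-- Admissible curve/velocity pairs: `p.1` is the curve, `p.2` its (locally integrable)
velocity; the curve starts at `x`, stays in the closure of `Ω`, and has integrable cost. -/
def Curves {n : ℕ} (Ω : Set (Euc n)) (L : Euc n → Euc n → ℝ) (x : Euc n) :
    Set ((ℝ → Euc n) × (ℝ → Euc n)) :=
  {p | (∀ t : ℝ, 0 ≤ t → IntegrableOn p.2 (Icc 0 t) volume) ∧
    (∀ t : ℝ, 0 ≤ t → p.1 t = x + ∫ s in Icc (0:ℝ) t, p.2 s) ∧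
    (∀ t : ℝ, 0 ≤ t → p.1 t ∈ closure Ω) ∧
    IntegrableOn (fun s => Real.exp (-s) * L (p.1 s) (-p.2 s)) (Ioi (0:ℝ)) volume}

/-- The cost functional `J[x, η] = ∫₀^∞ e^{-s} L(η(s), -η̇(s)) ds`. -/
def costJ {n : ℕ} (L : Euc n → Euc n → ℝ) (p : (ℝ → Euc n) × (ℝ → Euc n)) : ℝ :=
  ∫ s in Ioi (0:ℝ), Real.exp (-s) * L (p.1 s) (-p.2 s)

/-- The value function `u(x) = inf_{η ∈ A_x} J[x, η]`. -/
def valueFun {n : ℕ} (Ω : Set (Euc n)) (L : Euc n → Euc n → ℝ) (x : Euc n) : ℝ :=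
  sInf (costJ L '' Curves Ω L x)

/-- The Legendre transform `L(x,v) = sup_p (p·v - H(x,p))`. -/
def legendreTransform {n : ℕ} (H : Euc n → Euc n → ℝ) (x v : Euc n) : ℝ :=
  ⨆ p : Euc n, (@inner ℝ _ _ p v - H x p)

section Shift

variable {E : Type*} [NormedAddCommGroup E]

lemma integrableOn_Ioi_comp_add_iff (f : ℝ → E) (h : ℝ) :
    IntegrableOn (fun s => f (s + h)) (Ioi 0) volume ↔ IntegrableOn f (Ioi h) volume := by
  have := (measurePreserving_add_right (volume : Measure ℝ) h).integrableOn_comp_preimage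
    (measurableEmbedding_addRight h) (f := f) (s := Ioi h)
  simpa [Function.comp_def] using this

lemma integrableOn_Icc_comp_add_iff (f : ℝ → E) (h a b : ℝ) :
    IntegrableOn (fun s => f (s + h)) (Icc a b) volume ↔
      IntegrableOn f (Icc (a + h) (b + h)) volume := by
  have := (measurePreserving_add_right (volume : Measure ℝ) h).integrableOn_comp_preimage
    (measurableEmbedding_addRight h) (f := f) (s := Icc (a + h) (b + h))
  simpa [Function.comp_def] using this

variable [NormedSpace ℝ E]

lemma setIntegral_Ioi_comp_add (f : ℝ → E) (h : ℝ) :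
    ∫ s in Ioi (0:ℝ), f (s + h) = ∫ s in Ioi h, f s := by
  have := (measurePreserving_add_right (volume : Measure ℝ) h).setIntegral_preimage_emb
    (measurableEmbedding_addRight h) f (Ioi h)
  simpa using this

lemma setIntegral_Icc_comp_add (f : ℝ → E) (h a b : ℝ) :
    ∫ s in Icc a b, f (s + h) = ∫ s in Icc (a + h) (b + h), f s := by
  have := (measurePreserving_add_right (volume : Measure ℝ) h).setIntegral_preimage_emb
    (measurableEmbedding_addRight h) f (Icc (a + h) (b + h))
  simpa using this

lemma setIntegral_Icc_add_Icc {f : ℝ → E} {h t : ℝ} (h0 : 0 ≤ h) (ht : h ≤ t)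
    (hf : IntegrableOn f (Icc 0 t) volume) :
    ∫ s in Icc 0 t, f s = (∫ s in Icc 0 h, f s) + ∫ s in Icc h t, f s := by
  rw [integral_Icc_eq_integral_Ioc, integral_Icc_eq_integral_Ioc, integral_Icc_eq_integral_Ioc,
    ← Ioc_union_Ioc_eq_Ioc h0 ht]
  exact setIntegral_union (Ioc_disjoint_Ioc_of_le le_rfl) measurableSet_Ioc
    (hf.mono_set (Ioc_subset_Icc_self.trans (Icc_subset_Icc_right ht)))
    (hf.mono_set (Ioc_subset_Icc_self.trans (Icc_subset_Icc_left h0)))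

end Shift

lemma integrableOn_exp_neg_Ioi_zero : IntegrableOn (fun s : ℝ => Real.exp (-s)) (Ioi 0) :=
  integrableOn_exp_neg_Ioi 0

lemma setIntegral_exp_neg_Ioc {h : ℝ} (h0 : 0 ≤ h) :
    ∫ s in Ioc 0 h, Real.exp (-s) = 1 - Real.exp (-h) := by
  rw [← intervalIntegral.integral_of_le h0]
  simp

/-- A function whose right derivative at `0` exists and which stays above its value at `0`. -/
lemma HasDerivAt.nonneg_of_eventually_nonneg {g : ℝ → ℝ} {g' : ℝ} (hg : HasDerivAt g g' 0)
    (h0 : g 0 = 0) (h : ∀ᶠ t in 𝓝[>] (0:ℝ), 0 ≤ g t) : 0 ≤ g' := by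
  refine ge_of_tendsto hg.tendsto_slope_zero_right ?_
  filter_upwards [h, self_mem_nhdsWithin] with t ht htpos
  have : (0:ℝ) < t := htpos
  simp only [zero_add, h0, sub_zero, smul_eq_mul]
  positivity

section Curves

variable {n : ℕ} {L : Euc n → Euc n → ℝ} {x : Euc n} {q : (ℝ → Euc n) × (ℝ → Euc n)}

lemma Curves.integrableOn_velocity (hq : q ∈ Curves univ L x) {h : ℝ} (h0 : 0 ≤ h) :
    IntegrableOn q.2 (Ioc 0 h) volume :=
  (hq.1 h h0).mono_set Ioc_subset_Icc_self

lemma Curves.apply_sub_eq (hq : q ∈ Curves univ L x) {t : ℝ} (ht : 0 ≤ t) :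
    q.1 t - x = ∫ s in Ioc 0 t, q.2 s := by
  rw [hq.2.1 t ht, integral_Icc_eq_integral_Ioc, add_sub_cancel_left]

lemma Curves.norm_apply_sub_le (hq : q ∈ Curves univ L x) {t h : ℝ} (ht : 0 ≤ t) (hth : t ≤ h) :
    ‖q.1 t - x‖ ≤ ∫ s in Ioc 0 h, ‖q.2 s‖ := by
  rw [Curves.apply_sub_eq hq ht]
  exact (norm_integral_le_integral_norm _).trans
    (setIntegral_mono_set (Curves.integrableOn_velocity hq (ht.trans hth)).norm
      (ae_of_all _ fun _ => norm_nonneg _) (Ioc_subset_Ioc_right hth).eventuallyLE)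

/-- The time shift of an admissible curve is admissible from the shifted starting point. -/
lemma Curves.shift_mem (hq : q ∈ Curves univ L x) {h : ℝ} (h0 : 0 ≤ h) :
    ((fun s => q.1 (s + h)), (fun s => q.2 (s + h))) ∈ Curves univ L (q.1 h) := by
  refine ⟨fun t ht => ?_, fun t ht => ?_, fun t _ => by simp, ?_⟩
  · rw [integrableOn_Icc_comp_add_iff, zero_add]
    exact (hq.1 (t + h) (by linarith)).mono_set (Icc_subset_Icc_left h0)
  · simp only
    rw [setIntegral_Icc_comp_add, zero_add, hq.2.1 (t + h) (by linarith), hq.2.1 h h0,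
      setIntegral_Icc_add_Icc h0 (by linarith) (hq.1 (t + h) (by linarith)), add_assoc]
  · have h1 := (integrableOn_Ioi_comp_add_iff (fun s => Real.exp (-s) * L (q.1 s) (-q.2 s)) h).2
      (hq.2.2.2.mono_set (Ioi_subset_Ioi h0))
    refine IntegrableOn.congr_fun (h1.const_mul (Real.exp h)) (fun s _ => ?_) measurableSet_Ioi
    simp only
    rw [← mul_assoc, ← Real.exp_add]
    ring_nf

lemma costJ_eq_add_shift (hq : q ∈ Curves univ L x) {h : ℝ} (h0 : 0 ≤ h) :
    costJ L q = (∫ s in Ioc 0 h, Real.exp (-s) * L (q.1 s) (-q.2 s)) +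
      Real.exp (-h) * costJ L ((fun s => q.1 (s + h)), (fun s => q.2 (s + h))) := by
  unfold costJ
  rw [← Ioc_union_Ioi_eq_Ioi h0, setIntegral_union Ioc_disjoint_Ioi_same measurableSet_Ioi
    (hq.2.2.2.mono_set Ioc_subset_Ioi_self) (hq.2.2.2.mono_set (Ioi_subset_Ioi h0)),
    ← setIntegral_Ioi_comp_add, ← integral_const_mul, Ioc_union_Ioi_eq_Ioi h0]
  congr 2
  ext s
  rw [← mul_assoc, ← Real.exp_add]
  ring_nf

/-- Follow the constant velocity `w` up to time `h`, then the curve `q`. -/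
def prependLine (x w : Euc n) (h : ℝ) (q : (ℝ → Euc n) × (ℝ → Euc n)) :
    (ℝ → Euc n) × (ℝ → Euc n) :=
  (fun s => if s ≤ h then x + s • w else q.1 (s - h), fun s => if s ≤ h then w else q.2 (s - h))

lemma prependLine_shift_eqOn (w : Euc n) (h : ℝ) :
    EqOn (fun s => (prependLine x w h q).2 (s + h)) q.2 (Ioi 0) := by
  intro s hs
  have : ¬ s + h ≤ h := by simpa using hs
  simp [prependLine, this]

lemma prependLine_mem {w : Euc n} {h : ℝ} (h0 : 0 ≤ h) (hq : q ∈ Curves univ L (x + h • w))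
    (hL : IntegrableOn (fun s => Real.exp (-s) * L (x + s • w) (-w)) (Ioc 0 h) volume) :
    prependLine x w h q ∈ Curves univ L x := by
  have hI1 : EqOn (prependLine x w h q).2 (fun _ => w) (Icc 0 h) := fun s hs => by
    simp [prependLine, hs.2]
  have hI2 : ∀ t, IntegrableOn (prependLine x w h q).2 (Icc h t) volume := fun t => by
    rcases le_total h t with ht | ht
    · rw [integrableOn_Icc_iff_integrableOn_Ioc]
      have h1 := hq.1 (t - h) (by linarith)
      have := (integrableOn_Icc_comp_add_iff (fun s => q.2 (s - h)) h 0 (t - h)).1 (by simpa using h1)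
      rw [zero_add, sub_add_cancel] at this
      refine (this.mono_set Ioc_subset_Icc_self).congr_fun (fun s hs => ?_) measurableSet_Ioc
      simp [prependLine, hs.1]
    · exact (integrableOn_Icc_iff_integrableOn_Ioc).2 (by simp [Ioc_eq_empty_of_le ht])
  have hint : ∀ t, 0 ≤ t → IntegrableOn (prependLine x w h q).2 (Icc 0 t) volume := fun t ht => by
    have h1 : IntegrableOn (prependLine x w h q).2 (Icc 0 h) volume :=
      IntegrableOn.congr_fun (integrableOn_const (by simp)) hI1.symm measurableSet_Icc
    refine (h1.union (hI2 t)).mono_set fun s hs => ?_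
    rcases le_total s h with hsh | hsh
    · exact Or.inl ⟨hs.1, hsh⟩
    · exact Or.inr ⟨hsh, hs.2⟩
  have hline : ∀ t, 0 ≤ t → t ≤ h → ∫ s in Icc 0 t, (prependLine x w h q).2 s = t • w := by
    intro t ht hth
    rw [setIntegral_congr_fun measurableSet_Icc (hI1.mono (Icc_subset_Icc_right hth))]
    simp [ht]
  refine ⟨hint, fun t ht => ?_, fun t _ => by simp, ?_⟩
  · rcases le_or_gt t h with hth | hth
    · rw [hline t ht hth]
      simp [prependLine, hth]
    · rw [setIntegral_Icc_add_Icc h0 hth.le (hint t ht), hline h h0 le_rfl]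
      have e1 := setIntegral_Icc_comp_add (prependLine x w h q).2 h 0 (t - h)
      rw [zero_add, sub_add_cancel, integral_Icc_eq_integral_Ioc, setIntegral_congr_fun
        measurableSet_Ioc ((prependLine_shift_eqOn w h).mono Ioc_subset_Ioi_self)] at e1
      rw [← e1, ← add_assoc, ← integral_Icc_eq_integral_Ioc, ← hq.2.1 (t - h) (by linarith)]
      simp [prependLine, hth]
  · rw [← Ioc_union_Ioi_eq_Ioi h0]
    refine IntegrableOn.union ?_ ?_
    · refine hL.congr_fun (fun s hs => ?_) measurableSet_Ioc
      simp [prependLine, hs.2]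
    · rw [← integrableOn_Ioi_comp_add_iff]
      refine IntegrableOn.congr_fun (hq.2.2.2.const_mul (Real.exp (-h))) (fun s hs => ?_)
        measurableSet_Ioi
      have : ¬ s + h ≤ h := by simpa using hs
      simp only [prependLine, this, if_false, add_sub_cancel_right]
      rw [← mul_assoc, ← Real.exp_add]
      ring_nf

lemma costJ_prependLine {w : Euc n} {h : ℝ} (h0 : 0 ≤ h) (hq : q ∈ Curves univ L (x + h • w))
    (hL : IntegrableOn (fun s => Real.exp (-s) * L (x + s • w) (-w)) (Ioc 0 h) volume) :
    costJ L (prependLine x w h q) = (∫ s in Ioc 0 h, Real.exp (-s) * L (x + s • w) (-w)) +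
      Real.exp (-h) * costJ L q := by
  rw [costJ_eq_add_shift (prependLine_mem h0 hq hL) h0]
  congr 1
  · refine setIntegral_congr_fun measurableSet_Ioc fun s hs => ?_
    simp [prependLine, hs.2]
  · congr 1
    refine setIntegral_congr_fun measurableSet_Ioi fun s hs => ?_
    have : ¬ s + h ≤ h := by simpa using hs
    simp [prependLine, this]

lemma const_mem_Curves (L : Euc n → Euc n → ℝ) (x : Euc n) :
    ((fun _ => x), (fun _ => 0)) ∈ Curves univ L x := by
  refine ⟨fun t _ => by simp, fun t _ => by simp, fun t _ => by simp, ?_⟩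
  exact IntegrableOn.congr_fun (integrableOn_exp_neg_Ioi_zero.mul_const (L x 0))
    (fun s _ => by simp) measurableSet_Ioi

lemma costJ_const (L : Euc n → Euc n → ℝ) (x : Euc n) :
    costJ L ((fun _ => x), (fun _ => 0)) = L x 0 := by
  simp only [costJ, neg_zero]
  rw [integral_mul_const, integral_exp_neg_Ioi_zero, one_mul]

variable {c : ℝ}

lemma neg_le_costJ (hc : ∀ x v, -c ≤ L x v) (hq : q ∈ Curves univ L x) : -c ≤ costJ L q := by
  have h1 : ∫ s in Ioi (0:ℝ), Real.exp (-s) * (-c) = -c := by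
    rw [integral_mul_const, integral_exp_neg_Ioi_zero, one_mul]
  rw [← h1]
  exact setIntegral_mono_on (integrableOn_exp_neg_Ioi_zero.mul_const _) hq.2.2.2 measurableSet_Ioi
    fun s _ => mul_le_mul_of_nonneg_left (hc _ _) (Real.exp_pos _).le

lemma bddBelow_costJ_image (hc : ∀ x v, -c ≤ L x v) (x : Euc n) :
    BddBelow (costJ L '' Curves univ L x) :=
  ⟨-c, by rintro _ ⟨q, hq, rfl⟩; exact neg_le_costJ hc hq⟩

lemma costJ_image_nonempty (L : Euc n → Euc n → ℝ) (x : Euc n) :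
    (costJ L '' Curves univ L x).Nonempty :=
  ⟨_, _, const_mem_Curves L x, rfl⟩

lemma valueFun_le_costJ (hc : ∀ x v, -c ≤ L x v) (hq : q ∈ Curves univ L x) :
    valueFun univ L x ≤ costJ L q :=
  csInf_le (bddBelow_costJ_image hc x) ⟨q, hq, rfl⟩

lemma neg_le_valueFun (hc : ∀ x v, -c ≤ L x v) (x : Euc n) : -c ≤ valueFun univ L x :=
  le_csInf (costJ_image_nonempty L x) (by rintro _ ⟨q, hq, rfl⟩; exact neg_le_costJ hc hq)

lemma valueFun_le_const (hc : ∀ x v, -c ≤ L x v) (x : Euc n) : valueFun univ L x ≤ L x 0 :=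
  (valueFun_le_costJ hc (const_mem_Curves L x)).trans_eq (costJ_const L x)

/-- One half of the dynamic programming principle, along segments. -/
lemma valueFun_le_of_line (hc : ∀ x v, -c ≤ L x v) (hLc : ∀ v, Continuous fun y => L y v)
    {w : Euc n} {h A : ℝ} (h0 : 0 ≤ h) (hA : ∀ s ∈ Icc 0 h, L (x + s • w) (-w) ≤ A) :
    valueFun univ L x ≤
      A * (1 - Real.exp (-h)) + Real.exp (-h) * valueFun univ L (x + h • w) := by
  have hcont : Continuous fun s : ℝ => Real.exp (-s) * L (x + s • w) (-w) :=
    (by fun_prop : Continuous fun s : ℝ => Real.exp (-s)).mul ((hLc (-w)).comp (by fun_prop))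
  have hL := (hcont.integrableOn_Icc (a := 0) (b := h) (μ := volume)).mono_set
    Ioc_subset_Icc_self
  have hI : ∫ s in Ioc 0 h, Real.exp (-s) * L (x + s • w) (-w) ≤ A * (1 - Real.exp (-h)) := by
    rw [← setIntegral_exp_neg_Ioc h0, mul_comm, ← integral_mul_const]
    refine setIntegral_mono_on hL ?_ measurableSet_Ioc fun s hs =>
      mul_le_mul_of_nonneg_left (hA s ⟨hs.1.le, hs.2⟩) (Real.exp_pos _).le
    exact (integrableOn_exp_neg_Ioi_zero.mono_set Ioc_subset_Ioi_self).mul_const _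
  have key : (valueFun univ L x - A * (1 - Real.exp (-h))) * Real.exp h ≤
      valueFun univ L (x + h • w) := by
    refine le_csInf (costJ_image_nonempty L _) ?_
    rintro _ ⟨q, hq, rfl⟩
    have h1 := valueFun_le_costJ hc (prependLine_mem h0 hq hL)
    rw [costJ_prependLine h0 hq hL] at h1
    rw [← le_div_iff₀ (Real.exp_pos h), div_eq_mul_inv, ← Real.exp_neg]
    linarith
  rw [← le_div_iff₀ (Real.exp_pos h), div_eq_mul_inv, ← Real.exp_neg] at key
  linarith

lemma Curves.integrableOn_running_cost (hq : q ∈ Curves univ L x) (h : ℝ) :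
    IntegrableOn (fun s => L (q.1 s) (-q.2 s)) (Ioc 0 h) volume := by
  have h1 := hq.2.2.2.mono_set (Ioc_subset_Ioi_self : Ioc 0 h ⊆ Ioi 0)
  have h2 : IntegrableOn (fun s => Real.exp s * (Real.exp (-s) * L (q.1 s) (-q.2 s)))
      (Ioc 0 h) volume := by
    rw [← integrableOn_Icc_iff_integrableOn_Ioc] at h1 ⊢
    exact h1.continuousOn_mul Real.continuous_exp.continuousOn isCompact_Icc
  refine h2.congr_fun (fun s _ => ?_) measurableSet_Ioc
  simp only
  rw [← mul_assoc, ← Real.exp_add, add_neg_cancel, Real.exp_zero, one_mul]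

/-- The other half of the dynamic programming principle, with the discount factor removed. -/
lemma setIntegral_running_cost_add_valueFun_le (hc : ∀ x v, -c ≤ L x v)
    (hq : q ∈ Curves univ L x) {h : ℝ} (h0 : 0 ≤ h) :
    (∫ s in Ioc 0 h, (L (q.1 s) (-q.2 s) + c)) + valueFun univ L (q.1 h) ≤
      Real.exp h * (costJ L q + c) - c := by
  have hexp : IntegrableOn (fun s : ℝ => Real.exp (-s)) (Ioc 0 h) volume :=
    integrableOn_exp_neg_Ioi_zero.mono_set Ioc_subset_Ioi_self
  have hL1 := hq.2.2.2.mono_set (Ioc_subset_Ioi_self : Ioc 0 h ⊆ Ioi 0)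
  have hL2 := Curves.integrableOn_running_cost hq h
  have hadd : (∫ s in Ioc 0 h, Real.exp (-s) * L (q.1 s) (-q.2 s)) + (1 - Real.exp (-h)) * c =
      ∫ s in Ioc 0 h, Real.exp (-s) * (L (q.1 s) (-q.2 s) + c) := by
    rw [← setIntegral_exp_neg_Ioc h0, ← integral_mul_const, ← integral_add hL1 (hexp.mul_const _)]
    simp only [mul_add]
  have hmono : Real.exp (-h) * ∫ s in Ioc 0 h, (L (q.1 s) (-q.2 s) + c) ≤
      ∫ s in Ioc 0 h, Real.exp (-s) * (L (q.1 s) (-q.2 s) + c) := by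
    rw [← integral_const_mul]
    refine setIntegral_mono_on ((hL2.add (integrableOn_const (by simp))).const_mul _) ?_
      measurableSet_Ioc fun s hs => ?_
    · simp only [mul_add]
      exact hL1.add (hexp.mul_const _)
    · exact mul_le_mul_of_nonneg_right (Real.exp_le_exp.2 (by linarith [hs.2]))
        (by linarith [hc (q.1 s) (-q.2 s)])
  have hv := valueFun_le_costJ hc (Curves.shift_mem hq h0)
  have hv' := mul_le_mul_of_nonneg_left hv (Real.exp_pos (-h)).le
  have e := costJ_eq_add_shift hq h0
  have hfin : Real.exp (-h) * ((∫ s in Ioc 0 h, (L (q.1 s) (-q.2 s) + c)) +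
      valueFun univ L (q.1 h) + c) ≤ costJ L q + c := by
    linarith
  have := mul_le_mul_of_nonneg_left hfin (Real.exp_pos h).le
  rw [← mul_assoc, ← Real.exp_add, add_neg_cancel, Real.exp_zero, one_mul] at this
  linarith

end Curves

/-- A continuous convex function on `ℝⁿ` has a subgradient at every point. -/
lemma ConvexOn.exists_subgradient {n : ℕ} {f : Euc n → ℝ} (hf : ConvexOn ℝ univ f)
    (hc : Continuous f) (p : Euc n) : ∃ v : Euc n, ∀ q, f p + inner ℝ v (q - p) ≤ f q := by
  have hopen : IsOpen {z : Euc n × ℝ | z.1 ∈ univ ∧ f z.1 < z.2} := by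
    simpa using isOpen_lt (hc.comp continuous_fst) continuous_snd
  obtain ⟨F, hF⟩ := geometric_hahn_banach_open_point (x := (p, f p)) hf.convex_strict_epigraph
    hopen (by simp)
  have hsplit : ∀ (z : Euc n) (t : ℝ), F (z, t) = F (z, 0) + t * F (0, 1) := by
    intro z t
    rw [← smul_eq_mul, ← map_smul, ← map_add]
    simp
  have ha : F (0, 1) < 0 := by
    have := hF (p, f p + 1) ⟨mem_univ _, by simp⟩
    rw [hsplit p (f p), hsplit p (f p + 1)] at this
    linarith
  have hle : ∀ q, F (q, f q) ≤ F (p, f p) := by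
    intro q
    have hlim : Tendsto (fun t : ℝ => F (q, f q + t)) (𝓝[>] 0) (𝓝 (F (q, f q))) := by
      have : Continuous fun t : ℝ => F (q, f q + t) := by fun_prop
      simpa using (this.tendsto 0).mono_left nhdsWithin_le_nhds
    refine le_of_tendsto hlim ?_
    filter_upwards [self_mem_nhdsWithin] with t ht
    exact (hF (q, f q + t) ⟨mem_univ _, by simpa using ht⟩).le
  let G : StrongDual ℝ (Euc n) := F.comp (ContinuousLinearMap.inl ℝ (Euc n) ℝ)
  refine ⟨(-F (0, 1))⁻¹ • (InnerProductSpace.toDual ℝ (Euc n)).symm G, fun q => ?_⟩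
  rw [real_inner_smul_left, InnerProductSpace.toDual_symm_apply, map_sub]
  have hG : ∀ z, G z = F (z, 0) := fun z => rfl
  have h1 := hle q
  rw [hsplit q, hsplit p, ← hG, ← hG] at h1
  have ha' : 0 < -F (0, 1) := by linarith
  have h2 : (-F (0, 1))⁻¹ * (G q - G p) ≤ f q - f p := by
    rw [inv_mul_le_iff₀ ha']
    linarith
  linarith

section Legendre

variable {n : ℕ} {H : Euc n → Euc n → ℝ} {C₁ C₂ : ℝ}

lemma exists_inner_sub_le (hH1 : ∀ x p : Euc n, -H x p ≤ C₁)
    (hH6 : ∀ M : ℝ, ∃ r : ℝ, ∀ p : Euc n, r ≤ ‖p‖ → ∀ x : Euc n, M * ‖p‖ ≤ H x p) (M : ℝ) :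
    ∃ K, ∀ x v p : Euc n, ‖v‖ ≤ M → inner ℝ p v - H x p ≤ K := by
  obtain ⟨r, hr⟩ := hH6 M
  refine ⟨|r| * |M| + |C₁|, fun x v p hv => ?_⟩
  have h1 : inner ℝ p v ≤ ‖p‖ * M :=
    (real_inner_le_norm p v).trans (mul_le_mul_of_nonneg_left hv (norm_nonneg _))
  rcases le_total r ‖p‖ with h | h
  · have := hr p h x
    have : 0 ≤ |r| * |M| + |C₁| := by positivity
    linarith
  · have h2 : ‖p‖ * M ≤ |r| * |M| :=
      mul_le_mul (h.trans (le_abs_self r)) (le_abs_self M) ((norm_nonneg v).trans hv)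
        (abs_nonneg _)
    linarith [hH1 x p, le_abs_self C₁]

lemma inner_sub_le_legendreTransform (hH1 : ∀ x p : Euc n, -H x p ≤ C₁)
    (hH6 : ∀ M : ℝ, ∃ r : ℝ, ∀ p : Euc n, r ≤ ‖p‖ → ∀ x : Euc n, M * ‖p‖ ≤ H x p)
    (x v p : Euc n) : inner ℝ p v - H x p ≤ legendreTransform H x v := by
  obtain ⟨K, hK⟩ := exists_inner_sub_le hH1 hH6 ‖v‖
  exact le_ciSup (f := fun p : Euc n => inner ℝ p v - H x p)
    ⟨K, by rintro _ ⟨p, rfl⟩; exact hK x v p le_rfl⟩ p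

lemma exists_legendreTransform_le (hH1 : ∀ x p : Euc n, -H x p ≤ C₁)
    (hH6 : ∀ M : ℝ, ∃ r : ℝ, ∀ p : Euc n, r ≤ ‖p‖ → ∀ x : Euc n, M * ‖p‖ ≤ H x p) (M : ℝ) :
    ∃ K, ∀ x v : Euc n, ‖v‖ ≤ M → legendreTransform H x v ≤ K := by
  obtain ⟨K, hK⟩ := exists_inner_sub_le hH1 hH6 M
  exact ⟨K, fun x v hv => ciSup_le fun p => hK x v p hv⟩

lemma neg_le_legendreTransform (hH1 : ∀ x p : Euc n, -H x p ≤ C₁)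
    (hH2 : ∀ x : Euc n, |H x 0| ≤ C₂)
    (hH6 : ∀ M : ℝ, ∃ r : ℝ, ∀ p : Euc n, r ≤ ‖p‖ → ∀ x : Euc n, M * ‖p‖ ≤ H x p)
    (x v : Euc n) : -C₂ ≤ legendreTransform H x v := by
  have h1 := inner_sub_le_legendreTransform hH1 hH6 x v 0
  rw [inner_zero_left] at h1
  linarith [le_abs_self (H x 0), hH2 x]

lemma continuous_legendreTransform_left (hH1 : ∀ x p : Euc n, -H x p ≤ C₁)
    (hH2 : ∀ x : Euc n, |H x 0| ≤ C₂)
    (hH3c : ∀ r > (0:ℝ), ∃ C > (0:ℝ), ∀ x y p q : Euc n, ‖p‖ ≤ r → ‖q‖ ≤ r →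
      |H x p - H y p| ≤ C * ‖x - y‖ ∧ |H x p - H x q| ≤ C * ‖p - q‖)
    (hH6 : ∀ M : ℝ, ∃ r : ℝ, ∀ p : Euc n, r ≤ ‖p‖ → ∀ x : Euc n, M * ‖p‖ ≤ H x p)
    (v : Euc n) : Continuous fun x => legendreTransform H x v := by
  obtain ⟨r, hr⟩ := hH6 (‖v‖ + 1)
  obtain ⟨C, hC, hCL⟩ := hH3c (max 1 (max r C₂)) (by positivity)
  have key : ∀ x y, legendreTransform H x v ≤ legendreTransform H y v + C * dist x y := by
    intro x y
    refine ciSup_le fun p => ?_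
    rcases le_total ‖p‖ (max 1 (max r C₂)) with hp | hp
    · have h1 := (hCL x y p p hp hp).1
      have h2 := inner_sub_le_legendreTransform hH1 hH6 y v p
      rw [dist_eq_norm]
      linarith [neg_abs_le (H x p - H y p)]
    · have h1 := hr p ((le_max_left r C₂).trans ((le_max_right _ _).trans hp)) x
      have h2 := real_inner_le_norm p v
      have h3 := neg_le_legendreTransform hH1 hH2 hH6 y v
      have h4 : C₂ ≤ ‖p‖ := (le_max_right r C₂).trans ((le_max_right _ _).trans hp)
      have h5 : 0 ≤ C * dist x y := by positivity
      linarith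
  exact (LipschitzWith.of_le_add_mul ⟨C, hC.le⟩ key).continuous

/-- Fenchel–Moreau: the supremum defining the biconjugate of `H x` is attained. -/
lemma exists_legendreTransform_le_inner_sub (hHcont : Continuous (Function.uncurry H))
    (hH5 : ∀ x : Euc n, ConvexOn ℝ univ (H x)) (x p : Euc n) :
    ∃ v, legendreTransform H x v ≤ inner ℝ p v - H x p := by
  obtain ⟨v, hv⟩ := (hH5 x).exists_subgradient
    (hHcont.comp (Continuous.prodMk_right x) : Continuous (H x)) p
  refine ⟨v, ciSup_le fun q => ?_⟩
  have := hv q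
  rw [inner_sub_right, real_inner_comm, real_inner_comm p v] at this
  linarith

/-- Testing the Legendre transform with `p + a v / ‖v‖`. -/
lemma exists_inner_add_norm_le_legendreTransform (hH1 : ∀ x p : Euc n, -H x p ≤ C₁)
    (hH6 : ∀ M : ℝ, ∃ r : ℝ, ∀ p : Euc n, r ≤ ‖p‖ → ∀ x : Euc n, M * ‖p‖ ≤ H x p)
    (p : Euc n) {a : ℝ} (ha : 0 ≤ a) (v : Euc n) :
    ∃ q : Euc n, ‖q - p‖ ≤ a ∧
      ∀ x, inner ℝ p v + a * ‖v‖ - H x q ≤ legendreTransform H x v := by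
  rcases eq_or_ne v 0 with rfl | hv
  · exact ⟨p, by simpa using ha, fun x => by
      simpa using inner_sub_le_legendreTransform hH1 hH6 x 0 p⟩
  · have hv' : ‖v‖ ≠ 0 := norm_ne_zero_iff.2 hv
    refine ⟨p + (a * ‖v‖⁻¹) • v, ?_, fun x => ?_⟩
    · rw [add_sub_cancel_left, norm_smul, Real.norm_of_nonneg (by positivity), mul_assoc,
        inv_mul_cancel₀ hv', mul_one]
    · have h1 := inner_sub_le_legendreTransform hH1 hH6 x v (p + (a * ‖v‖⁻¹) • v)
      rw [inner_add_left, real_inner_smul_left, real_inner_self_eq_norm_sq] at h1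
      have h2 : a * ‖v‖⁻¹ * ‖v‖ ^ 2 = a * ‖v‖ := by field_simp
      linarith

/-- Uniform superlinearity of the Legendre transform. -/
lemma exists_mul_norm_sub_le_legendreTransform (hH1 : ∀ x p : Euc n, -H x p ≤ C₁)
    (hH2 : ∀ x : Euc n, |H x 0| ≤ C₂)
    (hH3c : ∀ r > (0:ℝ), ∃ C > (0:ℝ), ∀ x y p q : Euc n, ‖p‖ ≤ r → ‖q‖ ≤ r →
      |H x p - H y p| ≤ C * ‖x - y‖ ∧ |H x p - H x q| ≤ C * ‖p - q‖)
    (hH6 : ∀ M : ℝ, ∃ r : ℝ, ∀ p : Euc n, r ≤ ‖p‖ → ∀ x : Euc n, M * ‖p‖ ≤ H x p)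
    {M : ℝ} (hM : 0 < M) :
    ∃ B > (0:ℝ), ∀ x v, M * ‖v‖ - B ≤ legendreTransform H x v + C₂ := by
  obtain ⟨C, hC, hCL⟩ := hH3c M hM
  refine ⟨C * M, by positivity, fun x v => ?_⟩
  obtain ⟨q, hq, hqL⟩ := exists_inner_add_norm_le_legendreTransform hH1 hH6 0 hM.le v
  rw [sub_zero] at hq
  have h1 := hqL x
  have h2 := (hCL x x q 0 hq (by simpa using hM.le)).2
  rw [sub_zero] at h2
  have h3 : C * ‖q‖ ≤ C * M := by gcongr
  rw [inner_zero_left] at h1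
  linarith [le_abs_self (H x q - H x 0), le_abs_self (H x 0), hH2 x]

lemma eventually_forall_Icc_le {g : ℝ → ℝ} (hg : Continuous g) {A : ℝ} (h0 : g 0 < A) :
    ∀ᶠ h in 𝓝[>] (0:ℝ), ∀ s ∈ Icc 0 h, g s ≤ A := by
  obtain ⟨r, hr, hball⟩ := Metric.eventually_nhds_iff.1 (hg.tendsto 0 |>.eventually_lt_const h0)
  filter_upwards [Ioo_mem_nhdsGT hr] with h hh s hs
  refine (hball ?_).le
  rw [Real.dist_eq, sub_zero, abs_of_nonneg hs.1]
  exact hs.2.trans_lt hh.2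

lemma valueFun_subsolution (hHcont : Continuous (Function.uncurry H))
    (hH1 : ∀ x p : Euc n, -H x p ≤ C₁) (hH2 : ∀ x : Euc n, |H x 0| ≤ C₂)
    (hH3c : ∀ r > (0:ℝ), ∃ C > (0:ℝ), ∀ x y p q : Euc n, ‖p‖ ≤ r → ‖q‖ ≤ r →
      |H x p - H y p| ≤ C * ‖x - y‖ ∧ |H x p - H x q| ≤ C * ‖p - q‖)
    (hH5 : ∀ x : Euc n, ConvexOn ℝ univ (H x))
    (hH6 : ∀ M : ℝ, ∃ r : ℝ, ∀ p : Euc n, r ≤ ‖p‖ → ∀ x : Euc n, M * ‖p‖ ≤ H x p) :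
    IsViscositySubsolutionIn univ H (valueFun univ (legendreTransform H)) := by
  intro x _ φ hφ hmax
  set u := valueFun univ (legendreTransform H)
  set p := gradient φ x
  obtain ⟨v, hv⟩ := exists_legendreTransform_le_inner_sub hHcont hH5 x p
  have hLc := continuous_legendreTransform_left hH1 hH2 hH3c hH6
  have hpath : Continuous fun s : ℝ => x + s • (-v) := by fun_prop
  have hgrad : HasGradientAt φ p x := (hφ.differentiable one_ne_zero x).hasGradientAt
  suffices hA : ∀ A, legendreTransform H x v < A → u x ≤ A - inner ℝ p v by
    have := le_of_forall_gt_imp_ge_of_dense (a₁ := u x + inner ℝ p v)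
      (a₂ := legendreTransform H x v) fun A hA' => by linarith [hA A hA']
    linarith
  intro A hA
  have hφ' : HasDerivAt (fun h : ℝ => φ (x + h • (-v))) (-inner ℝ p v) 0 := by
    have h1 : HasDerivAt (fun h : ℝ => x + h • (-v)) (-v) 0 := by
      simpa using ((hasDerivAt_id (0:ℝ)).smul_const (-v)).const_add x
    have h2 : HasFDerivAt φ (InnerProductSpace.toDual ℝ _ p) (x + (0:ℝ) • (-v)) := by
      simpa using hgrad.hasFDerivAt
    simpa [Function.comp_def] using h2.comp_hasDerivAt (0:ℝ) h1
  have hexp : HasDerivAt (fun h : ℝ => Real.exp (-h)) (-1) 0 := by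
    simpa using (hasDerivAt_neg (0:ℝ)).exp
  have hg : HasDerivAt (fun h : ℝ => A * (1 - Real.exp (-h)) +
      Real.exp (-h) * (u x - φ x + φ (x + h • (-v))) - u x) (A - u x - inner ℝ p v) 0 := by
    refine ((((hexp.const_sub 1).const_mul A).add
      (hexp.mul (hφ'.const_add (u x - φ x)))).sub_const (u x)).congr_deriv ?_
    simp
    ring
  have hev : ∀ᶠ h in 𝓝[>] (0:ℝ), u (x + h • (-v)) - φ (x + h • (-v)) ≤ u x - φ x := by
    have hm : IsLocalMax (fun y => u y - φ y) x := isLocalMaxOn_univ_iff.1 hmax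
    have ht : Tendsto (fun h : ℝ => x + h • (-v)) (𝓝[>] 0) (𝓝 x) := by
      simpa using (hpath.tendsto 0).mono_left nhdsWithin_le_nhds
    exact ht.eventually hm
  have := hg.nonneg_of_eventually_nonneg (by simp) (by
    filter_upwards [hev, self_mem_nhdsWithin, eventually_forall_Icc_le ((hLc v).comp hpath)
      (A := A) (by simpa using hA)] with h h1 h2 h3
    have h4 := valueFun_le_of_line (neg_le_legendreTransform hH1 hH2 hH6) hLc (x := x) (w := -v)
      (A := A) (le_of_lt h2) (by simpa using h3)
    have h5 := mul_le_mul_of_nonneg_left (sub_le_iff_le_add.1 h1) (Real.exp_pos (-h)).le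
    linarith)
  linarith

lemma valueFun_supersolution (hHcont : Continuous (Function.uncurry H))
    (hH1 : ∀ x p : Euc n, -H x p ≤ C₁) (hC₂ : 0 < C₂) (hH2 : ∀ x : Euc n, |H x 0| ≤ C₂)
    (hH3c : ∀ r > (0:ℝ), ∃ C > (0:ℝ), ∀ x y p q : Euc n, ‖p‖ ≤ r → ‖q‖ ≤ r →
      |H x p - H y p| ≤ C * ‖x - y‖ ∧ |H x p - H x q| ≤ C * ‖p - q‖)
    (hH6 : ∀ M : ℝ, ∃ r : ℝ, ∀ p : Euc n, r ≤ ‖p‖ → ∀ x : Euc n, M * ‖p‖ ≤ H x p) :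
    IsViscositySupersolutionOn univ H (valueFun univ (legendreTransform H)) := by
  intro x _ φ hφ hmin
  set L := legendreTransform H
  set u := valueFun univ L
  set p := gradient φ x
  have hc := neg_le_legendreTransform hH1 hH2 hH6
  have hgrad : HasGradientAt φ p x := (hφ.differentiable one_ne_zero x).hasGradientAt
  refine le_of_forall_pos_le_add fun δ hδ => ?_
  obtain ⟨ε₀, hε₀, hHε⟩ := Metric.continuous_iff.1 hHcont (x, p) δ hδ
  set ε := ε₀ / 2 with hε
  have hεpos : 0 < ε := by positivity
  have htouch : ∀ᶠ y in 𝓝 x, u x + inner ℝ p (y - x) - ε * ‖y - x‖ ≤ u y := by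
    have h1 := (hasGradientAt_iff_isLittleO.1 hgrad).def hεpos
    have hm : IsLocalMin (fun y => u y - φ y) x := by
      rwa [closure_univ, isLocalMinOn_univ_iff] at hmin
    filter_upwards [h1, hm] with y hy1 hy2
    rw [Real.norm_eq_abs] at hy1
    linarith [neg_abs_le (φ y - φ x - inner ℝ p (y - x))]
  obtain ⟨r₁, hr₁, htouch⟩ := Metric.eventually_nhds_iff.1 htouch
  set r := min r₁ ε₀
  have hr : 0 < r := lt_min hr₁ hε₀
  have hlow : ∀ y v, dist y x < r → inner ℝ p v + ε * ‖v‖ - (H x p + δ) ≤ L y v := by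
    intro y v hy
    obtain ⟨q, hq, hqL⟩ := exists_inner_add_norm_le_legendreTransform hH1 hH6 p hεpos.le v
    have h1 := hHε (y, q) (by
      rw [Prod.dist_eq, max_lt_iff, dist_eq_norm q p]
      exact ⟨hy.trans_le (min_le_right _ _), hq.trans_lt (by simp [hε, hε₀])⟩)
    simp only [Function.uncurry, Real.dist_eq] at h1
    linarith [hqL y, le_abs_self (H y q - H x p)]
  set D := Real.exp 1 * (|u x| + 1 + C₂)
  have hD : 0 < D := by positivity
  obtain ⟨B, hB, hcoer⟩ := exists_mul_norm_sub_le_legendreTransform hH1 hH2 hH3c hH6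
    (M := 2 * (D + 1) / r) (by positivity)
  have hexp : HasDerivAt (fun h : ℝ => Real.exp h) 1 0 := by
    simpa using Real.hasDerivAt_exp 0
  have hg : HasDerivAt (fun h : ℝ => (Real.exp h - 1) * (u x + C₂) + Real.exp h * h ^ 2 -
      h * (C₂ - (H x p + δ))) (u x + H x p + δ) 0 := by
    refine ((((hexp.sub_const 1).mul_const (u x + C₂)).add
      (hexp.mul (hasDerivAt_pow 2 (0:ℝ)))).sub
      ((hasDerivAt_id (0:ℝ)).mul_const (C₂ - (H x p + δ)))).congr_deriv ?_
    simp
    ring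
  refine hg.nonneg_of_eventually_nonneg (by simp) ?_
  filter_upwards [Ioo_mem_nhdsGT (show (0:ℝ) < min 1 (1 / B) by positivity)] with h hh
  obtain ⟨h0, hh⟩ := hh
  obtain ⟨hh1, hhB⟩ := lt_min_iff.1 hh
  have hBh : B * h ≤ 1 := by
    rw [lt_div_iff₀ hB] at hhB
    linarith
  obtain ⟨_, ⟨q, hq, rfl⟩, hqlt⟩ := exists_lt_of_csInf_lt (costJ_image_nonempty L x)
    (show u x < u x + h ^ 2 by linarith [pow_pos h0 2])
  have hdpp := setIntegral_running_cost_add_valueFun_le hc hq h0.le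
  have hLint : IntegrableOn (fun s => L (q.1 s) (-q.2 s) + C₂) (Ioc 0 h) volume :=
    (Curves.integrableOn_running_cost hq h).add (integrableOn_const (by simp))
  have hvel := Curves.integrableOn_velocity hq h0.le
  set V := ∫ s in Ioc 0 h, ‖q.2 s‖ with hV
  have hrhs : Real.exp h * (costJ L q + C₂) ≤ Real.exp h * (u x + h ^ 2 + C₂) := by gcongr
  have hVr : V < r := by
    have h1 : 2 * (D + 1) / r * V - B * h ≤ ∫ s in Ioc 0 h, (L (q.1 s) (-q.2 s) + C₂) := by
      have e : ∫ s in Ioc 0 h, (2 * (D + 1) / r * ‖q.2 s‖ - B) = 2 * (D + 1) / r * V - B * h := by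
        rw [integral_sub (hvel.norm.const_mul _) (integrableOn_const (by simp)),
          integral_const_mul, ← hV]
        simp [h0.le, mul_comm]
      rw [← e]
      refine setIntegral_mono_on ((hvel.norm.const_mul _).sub (integrableOn_const (by simp)))
        hLint measurableSet_Ioc fun s _ => ?_
      simpa using hcoer (q.1 s) (-q.2 s)
    have h2 : -C₂ ≤ u (q.1 h) := neg_le_valueFun hc _
    have h3 : Real.exp h * (u x + h ^ 2 + C₂) ≤ D := by
      have : h ^ 2 ≤ 1 := by nlinarith
      have : 0 ≤ u x + C₂ := by linarith [neg_le_valueFun hc x]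
      exact mul_le_mul (Real.exp_le_exp.2 hh1.le) (by linarith [le_abs_self (u x)])
        (by linarith [sq_nonneg h]) (Real.exp_pos 1).le
    have h4 : 2 * (D + 1) / r * V ≤ D + 1 := by linarith
    rw [div_mul_eq_mul_div, div_le_iff₀ hr] at h4
    have h5 : 2 * V ≤ r := by
      by_contra! hcon
      nlinarith
    linarith
  have hball : ∀ t ∈ Icc 0 h, dist (q.1 t) x < r := fun t ht => by
    rw [dist_eq_norm]
    exact (Curves.norm_apply_sub_le hq ht.1 ht.2).trans_lt hVr
  have hcost : inner ℝ p (-(q.1 h - x)) + ε * V + h * (C₂ - (H x p + δ)) ≤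
      ∫ s in Ioc 0 h, (L (q.1 s) (-q.2 s) + C₂) := by
    have i1 : IntegrableOn (fun s => inner ℝ p (-q.2 s)) (Ioc 0 h) volume := hvel.neg.const_inner p
    have i2 : IntegrableOn (fun s => ε * ‖q.2 s‖) (Ioc 0 h) volume := hvel.norm.const_mul ε
    have i3 : IntegrableOn (fun _ : ℝ => C₂ - (H x p + δ)) (Ioc 0 h) volume :=
      integrableOn_const (by simp)
    have e : ∫ s in Ioc 0 h, (inner ℝ p (-q.2 s) + ε * ‖q.2 s‖ + (C₂ - (H x p + δ))) =
        inner ℝ p (-(q.1 h - x)) + ε * V + h * (C₂ - (H x p + δ)) := by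
      rw [integral_add (f := fun s => inner ℝ p (-q.2 s) + ε * ‖q.2 s‖) (i1.add i2) i3,
        integral_add i1 i2, integral_const_mul,
        Curves.apply_sub_eq hq h0.le, ← integral_neg,
        ← integral_inner (f := fun s => -q.2 s) hvel.neg, ← hV]
      simp [h0.le]
    rw [← e]
    refine setIntegral_mono_on ((i1.add i2).add i3) hLint measurableSet_Ioc fun s hs => ?_
    have := hlow (q.1 s) (-q.2 s) (hball s ⟨hs.1.le, hs.2⟩)
    rw [norm_neg] at this
    linarith
  have hend := htouch ((hball h ⟨h0.le, le_rfl⟩).trans_le (min_le_left _ _))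
  have hnorm : ε * ‖q.1 h - x‖ ≤ ε * V :=
    mul_le_mul_of_nonneg_left (Curves.norm_apply_sub_le hq h0.le le_rfl) hεpos.le
  rw [inner_neg_right] at hcost
  linarith

lemma exists_valueFun_bound_lipschitz
    (hH1 : ∀ x p : Euc n, -H x p ≤ C₁) (hC₂ : 0 < C₂) (hH2 : ∀ x : Euc n, |H x 0| ≤ C₂)
    (hH3c : ∀ r > (0:ℝ), ∃ C > (0:ℝ), ∀ x y p q : Euc n, ‖p‖ ≤ r → ‖q‖ ≤ r →
      |H x p - H y p| ≤ C * ‖x - y‖ ∧ |H x p - H x q| ≤ C * ‖p - q‖)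
    (hH6 : ∀ M : ℝ, ∃ r : ℝ, ∀ p : Euc n, r ≤ ‖p‖ → ∀ x : Euc n, M * ‖p‖ ≤ H x p) :
    ∃ C > (0:ℝ), (∀ x : Euc n, |valueFun univ (legendreTransform H) x| ≤ C) ∧
      LipschitzWith (Real.toNNReal C) (valueFun univ (legendreTransform H)) := by
  have hc := neg_le_legendreTransform hH1 hH2 hH6
  obtain ⟨K, hK⟩ := exists_legendreTransform_le hH1 hH6 1
  have hC : 0 < |K| + C₂ := by positivity
  refine ⟨|K| + C₂, hC, fun x => abs_le.2 ⟨?_, ?_⟩, LipschitzWith.of_le_add_mul _ fun x y => ?_⟩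
  · linarith [neg_le_valueFun hc x, abs_nonneg K]
  · linarith [valueFun_le_const hc x, hK x 0 (by simp), le_abs_self K]
  · rw [Real.coe_toNNReal _ hC.le]
    rcases eq_or_ne x y with rfl | hxy
    · simp
    have hd : 0 < dist x y := dist_pos.2 hxy
    set w := (dist x y)⁻¹ • (y - x)
    have hw : ‖w‖ = 1 := by
      rw [norm_smul, ← dist_eq_norm, dist_comm y x, norm_inv, Real.norm_of_nonneg hd.le,
        inv_mul_cancel₀ hd.ne']
    have hxw : x + dist x y • w = y := by
      rw [smul_smul, mul_inv_cancel₀ hd.ne', one_smul, add_sub_cancel]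
    have h1 := valueFun_le_of_line hc (continuous_legendreTransform_left hH1 hH2 hH3c hH6)
      (x := x) (w := w) (A := |K|) hd.le
      fun s _ => (hK _ _ (by rw [norm_neg, hw])).trans (le_abs_self K)
    rw [hxw] at h1
    have h2 : (|K| - valueFun univ (legendreTransform H) y) * (1 - Real.exp (-dist x y)) ≤
        (|K| + C₂) * dist x y :=
      mul_le_mul (by linarith [neg_le_valueFun hc y]) (by linarith [Real.add_one_le_exp (-dist x y)])
        (by linarith [Real.exp_le_one_iff.2 (neg_nonpos.2 hd.le)]) hC.le
    linarith

end Legendre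

/-- Theorem 5.5: the value function on `ℝⁿ` is a bounded, Lipschitz (hence uniformly
continuous) viscosity solution of `u + H(x, Du) = 0` in `ℝⁿ`. -/
theorem value_function_whole_space {n : ℕ}
    (H : Euc n → Euc n → ℝ) (hHcont : Continuous (Function.uncurry H))
    (C₁ : ℝ) (hC₁ : 0 < C₁) (hH1 : ∀ x p : Euc n, -H x p ≤ C₁)
    (C₂ : ℝ) (hC₂ : 0 < C₂) (hH2 : ∀ x : Euc n, |H x 0| ≤ C₂)
    (hH3c : ∀ r > (0:ℝ), ∃ C > (0:ℝ), ∀ x y p q : Euc n, ‖p‖ ≤ r → ‖q‖ ≤ r →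
      |H x p - H y p| ≤ C * ‖x - y‖ ∧ |H x p - H x q| ≤ C * ‖p - q‖)
    (hH5 : ∀ x : Euc n, ConvexOn ℝ univ (H x))
    (hH6 : ∀ M : ℝ, ∃ r : ℝ, ∀ p : Euc n, r ≤ ‖p‖ → ∀ x : Euc n, M * ‖p‖ ≤ H x p) :
    UniformContinuous (valueFun univ (legendreTransform H)) ∧
    IsViscositySubsolutionIn univ H (valueFun univ (legendreTransform H)) ∧
    IsViscositySupersolutionOn univ H (valueFun univ (legendreTransform H)) ∧
    ∃ C > (0:ℝ), (∀ x : Euc n, |valueFun univ (legendreTransform H) x| ≤ C) ∧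
      LipschitzWith (Real.toNNReal C) (valueFun univ (legendreTransform H)) := by
  obtain ⟨C, hC, hbound, hlip⟩ := exists_valueFun_bound_lipschitz hH1 hC₂ hH2 hH3c hH6
  exact ⟨hlip.uniformContinuous, valueFun_subsolution hHcont hH1 hH2 hH3c hH5 hH6,
    valueFun_supersolution hHcont hH1 hC₂ hH2 hH3c hH6, C, hC, hbound, hlip⟩
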